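/- arXiv:2210.01111 — 5 statements merged into one kernel-verified Lean document; each statement's English description precedes it below -/
import Mathlib

section
/- Let X have law N(x, σ²I) and Y have law N(x+δ, σ²I) on ℝ^d, and let F : ℝ^d → {0,1} be a random or deterministic measurable function. If W = {w ∈ ℝ^d : δᵀw ≤ β} for some β ∈ ℝ and Pr(F(X) = 1) ≥ Pr(X ∈ W), then Pr(F(Y) = 1) ≥ Pr(Y ∈ W). -/
open MeasureTheory ProbabilityTheory

/-- Isotropic Gaussian measure `N(m, σ²I)` on `ℝ^d`, as a product of 1-D Gaussians. -/
noncomputable def gaussPi (d : ℕ) (m : Fin d → ℝ) (σ : ℝ) : Measure (Fin d → ℝ) :=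
  Measure.pi fun i => gaussianReal (m i) ⟨σ ^ 2, sq_nonneg σ⟩

/-- Standard Gaussian CDF `Φ`. -/
noncomputable def Phi (x : ℝ) : ℝ := (gaussianReal 0 1 (Set.Iic x)).toReal

/-- Inverse of the standard Gaussian CDF, `Φ⁻¹` (genuine inverse on `(0,1)` since `Φ` is a
strictly increasing continuous bijection from `ℝ` onto `(0,1)`). -/
noncomputable def PhiInv : ℝ → ℝ := Function.invFun Phi

/-- Euclidean dot product `aᵀb` on `ℝ^d`. -/
noncomputable def dotp (d : ℕ) (a b : Fin d → ℝ) : ℝ := ∑ i, a i * b i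

/-- Euclidean norm `‖a‖₂` on `ℝ^d`. -/
noncomputable def enorm2 (d : ℕ) (a : Fin d → ℝ) : ℝ := Real.sqrt (∑ i, a i ^ 2)

/-- The product of exponentially tilted finite measures is the tilting of the product measure by
the sum of the tilting functions. -/
lemma pi_tilted {ι : Type*} [Fintype ι] {E : ι → Type*} [∀ i, MeasurableSpace (E i)]
    (μ : ∀ i, Measure (E i)) [∀ i, IsFiniteMeasure (μ i)] (f : ∀ i, E i → ℝ) :
    Measure.pi (fun i => (μ i).tilted (f i)) =
      (Measure.pi μ).tilted (fun w => ∑ i, f i (w i)) := by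
  refine Measure.pi_eq fun s _ => ?_
  simp_rw [tilted_apply_eq_ofReal_integral]
  rw [Measure.restrict_pi_pi]
  simp_rw [Real.exp_sum]
  rw [integral_fintype_prod_eq_prod (fun i (y : E i) => Real.exp (f i y))]
  simp_rw [← Finset.prod_div_distrib]
  rw [integral_fintype_prod_eq_prod
    (fun i (y : E i) => Real.exp (f i y) / ∫ z, Real.exp (f i z) ∂(μ i))]
  exact ENNReal.ofReal_prod_of_nonneg fun i _ => integral_nonneg fun y => by positivity

/-- Linear exponential tilting of a real Gaussian translates its mean. -/
lemma gaussianReal_tilted_mul (m : ℝ) {v : NNReal} (hv : v ≠ 0) (t : ℝ) :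
    (gaussianReal m v).tilted (fun y => t * y) = gaussianReal (m + v * t) v := by
  have hmgf : ∫ y, Real.exp (t * y) ∂(gaussianReal m v) = Real.exp (m * t + v * t ^ 2 / 2) :=
    congrFun mgf_fun_id_gaussianReal t
  rw [Measure.tilted, hmgf, gaussianReal_of_var_ne_zero _ hv, gaussianReal_of_var_ne_zero _ hv,
    ← withDensity_mul _ (measurable_gaussianPDF m v) (by fun_prop)]
  congr 1
  ext y
  have hv' : (v : ℝ) ≠ 0 := by exact_mod_cast hv
  rw [Pi.mul_apply, gaussianPDF, gaussianPDF, ← ENNReal.ofReal_mul (gaussianPDFReal_nonneg _ _ _),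
    gaussianPDFReal, gaussianPDFReal, ← Real.exp_sub, mul_assoc, ← Real.exp_add]
  congr 3
  field_simp
  ring

/-- Neyman–Pearson for an exponential tilting: among tests of at least the same level, the
sublevel set of the tilting function has the smallest power under the tilted measure. -/
lemma tilted_sublevel_le_integral {Ω : Type*} [MeasurableSpace Ω] (μ : Measure Ω)
    [IsFiniteMeasure μ] {f g : Ω → ℝ} (hf : Measurable f) (hg : Measurable g)
    (hg01 : ∀ w, g w ∈ Set.Icc (0 : ℝ) 1) (c : ℝ)
    (h : μ.real {w | f w ≤ c} ≤ ∫ w, g w ∂μ) :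
    (μ.tilted f).real {w | f w ≤ c} ≤ ∫ w, g w ∂(μ.tilted f) := by
  by_cases hint : Integrable (fun w => Real.exp (f w)) μ
  swap
  · simp [tilted_of_not_integrable hint]
  set W := {w | f w ≤ c} with hW
  have hWm : MeasurableSet W := measurableSet_le hf measurable_const
  set u : Ω → ℝ := W.indicator 1 with hu
  have hum : Measurable u := measurable_one.indicator hWm
  have hu01 : ∀ w, u w ∈ Set.Icc (0 : ℝ) 1 := fun w => by
    by_cases hw : w ∈ W <;> simp [hu, hw]
  have bound : ∀ {k : Ω → ℝ}, (∀ w, k w ∈ Set.Icc (0 : ℝ) 1) → ∀ᵐ w ∂μ, ‖k w‖ ≤ 1 :=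
    fun hk => .of_forall fun w => by
      rw [Real.norm_of_nonneg (hk w).1]
      exact (hk w).2
  have hgi : Integrable g μ := .of_bound hg.aestronglyMeasurable 1 (bound hg01)
  have hui : Integrable u μ := .of_bound hum.aestronglyMeasurable 1 (bound hu01)
  have hge := hint.mul_bdd hg.aestronglyMeasurable (bound hg01)
  have hue := hint.mul_bdd hum.aestronglyMeasurable (bound hu01)
  rw [← integral_indicator_one hWm] at h ⊢
  rw [integral_tilted, integral_tilted]
  simp_rw [smul_eq_mul, div_mul_eq_mul_div, integral_div]
  refine div_le_div_of_nonneg_right ?_ (integral_nonneg fun w => (Real.exp_pos _).le)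
  have key : ∫ w, Real.exp c * (g w - u w) ∂μ ≤
      ∫ w, (Real.exp (f w) * g w - Real.exp (f w) * u w) ∂μ := by
    refine integral_mono ((hgi.sub hui).const_mul _) (hge.sub hue) fun w => ?_
    obtain ⟨h0, h1⟩ := hg01 w
    by_cases hw : f w ≤ c
    · have : u w = 1 := Set.indicator_of_mem (s := W) hw _
      have := Real.exp_le_exp.2 hw
      simp only [*]
      nlinarith
    · have : u w = 0 := Set.indicator_of_notMem (s := W) hw _
      have := Real.exp_le_exp.2 (not_le.1 hw).le
      simp only [*]
      nlinarith
  rw [integral_const_mul, integral_sub hgi hui, integral_sub hge hue] at key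
  have := mul_nonneg (Real.exp_pos c).le (sub_nonneg.2 h)
  linarith

lemma gaussPi_eq_pi (d : ℕ) (m : Fin d → ℝ) (σ : ℝ) :
    gaussPi d m σ = Measure.pi fun i => gaussianReal (m i) (NNReal.mk (σ ^ 2) (sq_nonneg σ)) :=
  rfl

instance (d : ℕ) (m : Fin d → ℝ) (σ : ℝ) : IsProbabilityMeasure (gaussPi d m σ) := by
  rw [gaussPi_eq_pi]
  infer_instance

/-- Translating an isotropic Gaussian amounts to tilting it by a linear form. -/
lemma gaussPi_add_eq_tilted {d : ℕ} (x δ : Fin d → ℝ) {σ : ℝ} (hσ : 0 < σ) :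
    gaussPi d (x + δ) σ = (gaussPi d x σ).tilted (fun w => dotp d δ w / σ ^ 2) := by
  have hv : NNReal.mk (σ ^ 2) (sq_nonneg σ) ≠ 0 :=
    fun h => (pow_pos hσ 2).ne' (congrArg NNReal.toReal h)
  have hlin : (fun w => dotp d δ w / σ ^ 2) = fun w => ∑ i, δ i / σ ^ 2 * w i := by
    ext w
    rw [dotp, Finset.sum_div]
    exact Finset.sum_congr rfl fun i _ => by ring
  rw [hlin, gaussPi_eq_pi, gaussPi_eq_pi, ← pi_tilted _ (fun i y => δ i / σ ^ 2 * y)]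
  congr 1
  ext1 i
  rw [gaussianReal_tilted_mul _ hv, NNReal.coe_mk, mul_div_cancel₀ _ (pow_pos hσ 2).ne',
    Pi.add_apply]

/-- Neyman–Pearson for Gaussians with different means, part (1):
if `W = {w | δᵀw ≤ β}` and `Pr(F(X)=1) ≥ Pr(X ∈ W)`, then `Pr(F(Y)=1) ≥ Pr(Y ∈ W)`,
where `X ~ N(x, σ²I)`, `Y ~ N(x+δ, σ²I)` and the random function `F` is represented by
the measurable map `F1 = F(1|·) : ℝ^d → [0,1]`. -/
theorem stmt0 {d : ℕ} (x δ : Fin d → ℝ) (σ : ℝ) (hσ : 0 < σ)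
    (F1 : (Fin d → ℝ) → ℝ) (hF1m : Measurable F1)
    (hF1 : ∀ w, F1 w ∈ Set.Icc (0 : ℝ) 1)
    (β : ℝ) (W : Set (Fin d → ℝ)) (hW : W = {w | dotp d δ w ≤ β})
    (h : ((gaussPi d x σ) W).toReal ≤ ∫ w, F1 w ∂(gaussPi d x σ)) :
    ((gaussPi d (x + δ) σ) W).toReal ≤ ∫ w, F1 w ∂(gaussPi d (x + δ) σ) := by
  have hW' : W = {w | dotp d δ w / σ ^ 2 ≤ β / σ ^ 2} := by
    ext w
    simp [hW, div_le_div_iff_of_pos_right (pow_pos hσ 2)]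
  have hf : Measurable fun w => dotp d δ w / σ ^ 2 := by
    unfold dotp
    fun_prop
  rw [hW'] at h ⊢
  rw [gaussPi_add_eq_tilted x δ hσ]
  exact tilted_sublevel_le_integral _ hf hF1m hF1 _ h
end

section
/- Assume δ ≠ 0 and let q ∈ (0,1). Define the half-space A = {w ∈ ℝ^d : δᵀ(w − x) ≤ σ‖δ‖₂ Φ⁻¹(q)}. Then Pr(X ∈ A) = q and Pr(Y ∈ A) = Φ(Φ⁻¹(q) − ‖δ‖₂/σ). -/
open MeasureTheory ProbabilityTheory

/-- The cumulative distribution function of an atomless probability measure is continuous. -/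
theorem continuous_cdf (μ : Measure ℝ) [IsProbabilityMeasure μ] [NullSingletonClass μ] :
    Continuous (cdf μ) := by
  refine continuous_iff_continuousAt.2 fun t => ?_
  rw [(monotone_cdf μ).continuousAt_iff_leftLim_eq_rightLim, (cdf μ).rightLim_eq]
  refine le_antisymm ((monotone_cdf μ).leftLim_le le_rfl) ?_
  have h := (cdf μ).measure_singleton t
  rw [measure_cdf, measure_singleton] at h
  simpa using ENNReal.ofReal_eq_zero.1 h.symm

/-- `Φ` attains every value in `(0,1)`, so `Φ⁻¹` is a right inverse of `Φ` there. -/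
theorem Phi_PhiInv {q : ℝ} (hq : q ∈ Set.Ioo (0 : ℝ) 1) : Phi (PhiInv q) = q := by
  have := nullSingletonClass_gaussianReal (μ := 0) one_ne_zero
  have hPhi : Phi = cdf (gaussianReal 0 1) :=
    funext fun t => (cdf_eq_real (gaussianReal 0 1) t).symm
  refine Function.invFun_eq (f := Phi) (b := q) ?_
  rw [hPhi]
  exact mem_range_of_exists_le_of_exists_ge (continuous_cdf _)
    ((tendsto_cdf_atBot _).eventually_le_const hq.1).exists
    ((tendsto_cdf_atTop _).eventually_const_le hq.2).exists

theorem gaussianReal_one_Iic_toReal (μ t : ℝ) :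
    (gaussianReal μ 1 (Set.Iic t)).toReal = Phi (t - μ) := by
  have h := gaussianReal_map_add_const (μ := 0) (v := 1) μ
  rw [zero_add] at h
  rw [← h, Measure.map_apply (by fun_prop) measurableSet_Iic, Phi, Set.preimage_add_const_Iic]

/-- A linear combination of independent Gaussians is Gaussian. -/
theorem map_sum_mul_pi_gaussianReal {ι : Type*} [Fintype ι] (a m : ι → ℝ) (v : ι → NNReal)
    {V : NNReal} (hV : (V : ℝ) = ∑ i, a i ^ 2 * v i) :
    (Measure.pi fun i => gaussianReal (m i) (v i)).map (fun w => ∑ i, a i * w i) =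
      gaussianReal (∑ i, a i * m i) V := by
  have hmeas : Measurable fun w : ι → ℝ => ∑ i, a i * w i := by fun_prop
  have := Measure.isProbabilityMeasure_map
    (μ := Measure.pi fun i => gaussianReal (m i) (v i)) hmeas.aemeasurable
  refine Measure.ext_of_charFun (funext fun t => ?_)
  rw [charFun_gaussianReal, charFun_apply_real, integral_map hmeas.aemeasurable (by fun_prop)]
  have hexp : ∀ w : ι → ℝ, Complex.exp (t * (∑ i, a i * w i : ℝ) * Complex.I) =
      ∏ i, Complex.exp ((t * a i : ℝ) * w i * Complex.I) := fun w => by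
    rw [← Complex.exp_sum]
    push_cast
    simp only [Finset.mul_sum, Finset.sum_mul, mul_assoc]
  simp_rw [hexp]
  rw [integral_fintype_prod_eq_prod
    (f := fun i (y : ℝ) => Complex.exp ((t * a i : ℝ) * y * Complex.I))]
  simp_rw [← charFun_apply_real, charFun_gaussianReal]
  rw [← Complex.exp_sum, Finset.sum_sub_distrib]
  congr 1
  rw [hV]
  push_cast
  simp only [Finset.mul_sum, Finset.sum_mul, Finset.sum_div]
  congr 1 <;> exact Finset.sum_congr rfl fun i _ => by ring

theorem sq_enorm2 (d : ℕ) (a : Fin d → ℝ) : enorm2 d a ^ 2 = ∑ i, a i ^ 2 :=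
  Real.sq_sqrt (Finset.sum_nonneg fun i _ => sq_nonneg (a i))

theorem enorm2_pos {d : ℕ} {a : Fin d → ℝ} (ha : a ≠ 0) : 0 < enorm2 d a := by
  obtain ⟨i, hi⟩ := Function.ne_iff.1 ha
  exact Real.sqrt_pos.2 (Finset.sum_pos' (fun j _ => sq_nonneg (a j))
    ⟨i, Finset.mem_univ i, sq_pos_iff.2 hi⟩)

theorem gaussPi_eq_pi_toNNReal (d : ℕ) (m : Fin d → ℝ) (σ : ℝ) :
    gaussPi d m σ = Measure.pi fun i => gaussianReal (m i) (σ ^ 2).toNNReal := by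
  rw [Real.toNNReal_of_nonneg (sq_nonneg σ)]
  rfl

/-- The isotropic Gaussian measure of a half-space. -/
theorem gaussPi_halfSpace {d : ℕ} (x m : Fin d → ℝ) {δ : Fin d → ℝ} (hδ : δ ≠ 0) {σ : ℝ}
    (hσ : 0 < σ) (c : ℝ) :
    (gaussPi d m σ {w | dotp d δ (w - x) ≤ σ * enorm2 d δ * c}).toReal =
      Phi (c - dotp d δ (m - x) / (σ * enorm2 d δ)) := by
  have hr : 0 < σ * enorm2 d δ := mul_pos hσ (enorm2_pos hδ)
  have hdot : ∀ w, dotp d δ (w - x) / (σ * enorm2 d δ) =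
      (∑ i, δ i / (σ * enorm2 d δ) * w i) - ∑ i, δ i / (σ * enorm2 d δ) * x i := fun w => by
    rw [dotp, Finset.sum_div, ← Finset.sum_sub_distrib]
    exact Finset.sum_congr rfl fun i _ => by rw [Pi.sub_apply]; ring
  have hset : {w | dotp d δ (w - x) ≤ σ * enorm2 d δ * c} =
      (fun w : Fin d → ℝ => ∑ i, δ i / (σ * enorm2 d δ) * w i) ⁻¹'
        Set.Iic (c + ∑ i, δ i / (σ * enorm2 d δ) * x i) := by
    ext w
    rw [Set.mem_ofPred_eq, Set.mem_preimage, Set.mem_Iic, ← sub_le_iff_le_add, ← hdot,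
      div_le_iff₀' hr]
  have hvar : ((1 : NNReal) : ℝ) =
      ∑ i, (δ i / (σ * enorm2 d δ)) ^ 2 * ((σ ^ 2).toNNReal : ℝ) := by
    simp only [NNReal.coe_one, Real.coe_toNNReal _ (sq_nonneg σ), div_pow]
    rw [← Finset.sum_mul, ← Finset.sum_div, ← sq_enorm2, mul_pow]
    have := hσ.ne'
    have := (enorm2_pos hδ).ne'
    field_simp
  rw [hset, gaussPi_eq_pi_toNNReal, ← Measure.map_apply (by fun_prop) measurableSet_Iic,
    map_sum_mul_pi_gaussianReal _ _ _ hvar, gaussianReal_one_Iic_toReal, hdot]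
  congr 1
  ring

/-- For `q ∈ (0,1)` and the half-space `A = {w | δᵀ(w−x) ≤ σ‖δ‖₂ Φ⁻¹(q)}`:
`Pr(X ∈ A) = q` and `Pr(Y ∈ A) = Φ(Φ⁻¹(q) − ‖δ‖₂/σ)`, where `X ~ N(x, σ²I)` and
`Y ~ N(x+δ, σ²I)`. -/
theorem stmt2 {d : ℕ} (x δ : Fin d → ℝ) (hδ : δ ≠ 0) (σ : ℝ) (hσ : 0 < σ)
    (q : ℝ) (hq : q ∈ Set.Ioo (0 : ℝ) 1)
    (A : Set (Fin d → ℝ))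
    (hA : A = {w | dotp d δ (w - x) ≤ σ * enorm2 d δ * PhiInv q}) :
    ((gaussPi d x σ) A).toReal = q ∧
    ((gaussPi d (x + δ) σ) A).toReal = Phi (PhiInv q - enorm2 d δ / σ) := by
  have hnorm := (enorm2_pos hδ).ne'
  have hself : dotp d δ δ = enorm2 d δ ^ 2 := by rw [sq_enorm2]; simp only [dotp, sq]
  subst hA
  refine ⟨?_, ?_⟩
  · rw [gaussPi_halfSpace x x hδ hσ, sub_self, show dotp d δ 0 = 0 by simp [dotp], zero_div,
      sub_zero, Phi_PhiInv hq]
  · rw [gaussPi_halfSpace x (x + δ) hδ hσ, add_sub_cancel_left, hself]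
    congr 2
    field_simp
end

section
/- Let X and Y be random vectors in ℝ^d whose laws have densities p_X and p_Y with respect to Lebesgue measure, let F₁, …, F_t : ℝ^d → {0,1} be random or deterministic measurable functions, and let k' be a positive integer such that ∑_{i=1}^t F_i(1|w) ≤ k' for all w ∈ ℝ^d. If W = {w ∈ ℝ^d : p_Y(w) ≤ μ · p_X(w)} for some μ > 0 and (1/k') ∑_{i=1}^t Pr(F_i(X) = 1) ≥ Pr(X ∈ W), then (1/k') ∑_{i=1}^t Pr(F_i(Y) = 1) ≥ Pr(Y ∈ W). -/
open MeasureTheory ProbabilityTheory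

theorem integral_withDensity_ofReal {α : Type*} [MeasurableSpace α] {ν : Measure α}
    {p : α → ℝ} (hpm : Measurable p) (hp0 : ∀ w, 0 ≤ p w) (g : α → ℝ) :
    ∫ w, g w ∂(ν.withDensity fun w => ENNReal.ofReal (p w)) = ∫ w, p w * g w ∂ν := by
  rw [integral_withDensity_eq_integral_toReal_smul hpm.ennreal_ofReal
    (Filter.Eventually.of_forall fun _ => ENNReal.ofReal_lt_top)]
  simp only [ENNReal.toReal_ofReal (hp0 _), smul_eq_mul]

theorem integrable_withDensity_ofReal_iff {α : Type*} [MeasurableSpace α] {ν : Measure α}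
    {p : α → ℝ} (hpm : Measurable p) (hp0 : ∀ w, 0 ≤ p w) {g : α → ℝ} :
    Integrable g (ν.withDensity fun w => ENNReal.ofReal (p w)) ↔
      Integrable (fun w => p w * g w) ν := by
  rw [integrable_withDensity_iff_integrable_smul' hpm.ennreal_ofReal
    (Filter.Eventually.of_forall fun _ => ENNReal.ofReal_lt_top)]
  simp only [ENNReal.toReal_ofReal (hp0 _), smul_eq_mul]

/-- The Neyman–Pearson inequality for a single randomized test `g` against the sublevel set of the
likelihood ratio. -/
theorem measureReal_sublevel_sub_integral_le {α : Type*} [MeasurableSpace α] {ν : Measure α}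
    {p q : α → ℝ} (hpm : Measurable p) (hqm : Measurable q)
    (hp0 : ∀ w, 0 ≤ p w) (hq0 : ∀ w, 0 ≤ q w)
    [IsFiniteMeasure (ν.withDensity fun w => ENNReal.ofReal (p w))]
    [IsFiniteMeasure (ν.withDensity fun w => ENNReal.ofReal (q w))]
    {g : α → ℝ} (hgm : Measurable g) (hg01 : ∀ w, g w ∈ Set.Icc (0 : ℝ) 1) (c : ℝ) :
    (ν.withDensity fun w => ENNReal.ofReal (q w)).real {w | q w ≤ c * p w}
        - ∫ w, g w ∂(ν.withDensity fun w => ENNReal.ofReal (q w)) ≤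
      c * ((ν.withDensity fun w => ENNReal.ofReal (p w)).real {w | q w ≤ c * p w}
        - ∫ w, g w ∂(ν.withDensity fun w => ENNReal.ofReal (p w))) := by
  set W : Set α := {w | q w ≤ c * p w}
  have hW : MeasurableSet W := measurableSet_le hqm (hpm.const_mul c)
  have hg : ∀ (ρ : Measure α) [IsFiniteMeasure ρ], Integrable g ρ := fun ρ _ =>
    Integrable.of_bound hgm.aestronglyMeasurable 1 (Filter.Eventually.of_forall fun w => by
      rw [Real.norm_of_nonneg (hg01 w).1]
      exact (hg01 w).2)
  have hind : ∀ (ρ : Measure α) [IsFiniteMeasure ρ], Integrable (W.indicator (1 : α → ℝ)) ρ :=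
    fun ρ _ => (integrable_const (1 : ℝ)).indicator hW
  rw [← integral_indicator_one hW, ← integral_indicator_one hW, ← integral_sub (hind _) (hg _),
    ← integral_sub (hind _) (hg _), integral_withDensity_ofReal hqm hq0,
    integral_withDensity_ofReal hpm hp0, ← integral_const_mul]
  refine integral_mono ((integrable_withDensity_ofReal_iff hqm hq0).1 ((hind _).sub (hg _)))
    (((integrable_withDensity_ofReal_iff hpm hp0).1 ((hind _).sub (hg _))).const_mul c)
    fun w => ?_
  obtain ⟨h0, h1⟩ := hg01 w
  by_cases hw : w ∈ W
  · have hw' : q w ≤ c * p w := hw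
    simp only [Set.indicator_of_mem hw, Pi.one_apply]
    nlinarith
  · have hw' : c * p w < q w := not_le.1 hw
    simp only [Set.indicator_of_notMem hw]
    nlinarith

/-- Neyman–Pearson variant for multiple functions, part (1): `X, Y` random vectors with
densities `pX, pY` w.r.t. Lebesgue measure, measurable random functions
`F₁,…,F_t : ℝ^d → {0,1}` (represented by `F i = F_i(1|·) : ℝ^d → [0,1]`) with
`∑ᵢ F_i(1|w) ≤ k'` everywhere. If `W = {w | pY(w) ≤ μ·pX(w)}` for some `μ > 0` and
`(1/k') ∑ᵢ Pr(F_i(X)=1) ≥ Pr(X ∈ W)`, then `(1/k') ∑ᵢ Pr(F_i(Y)=1) ≥ Pr(Y ∈ W)`. -/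
theorem stmt4 {d : ℕ} (μX μY : Measure (Fin d → ℝ))
    [IsProbabilityMeasure μX] [IsProbabilityMeasure μY]
    (pX pY : (Fin d → ℝ) → ℝ) (hpXm : Measurable pX) (hpYm : Measurable pY)
    (hpX0 : ∀ w, 0 ≤ pX w) (hpY0 : ∀ w, 0 ≤ pY w)
    (hX : μX = volume.withDensity fun w => ENNReal.ofReal (pX w))
    (hY : μY = volume.withDensity fun w => ENNReal.ofReal (pY w))
    (t : ℕ) (F : Fin t → (Fin d → ℝ) → ℝ)
    (hFm : ∀ i, Measurable (F i)) (hF01 : ∀ i w, F i w ∈ Set.Icc (0 : ℝ) 1)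
    (k' : ℕ) (hk' : 1 ≤ k') (hsum : ∀ w, ∑ i, F i w ≤ (k' : ℝ))
    (μ : ℝ) (hμ : 0 < μ)
    (W : Set (Fin d → ℝ)) (hW : W = {w | pY w ≤ μ * pX w})
    (h : (μX W).toReal ≤ (1 / (k' : ℝ)) * ∑ i, ∫ w, F i w ∂μX) :
    (μY W).toReal ≤ (1 / (k' : ℝ)) * ∑ i, ∫ w, F i w ∂μY := by
  have hk : (0 : ℝ) < k' := by exact_mod_cast hk'
  have hmean : ∀ (ρ : Measure (Fin d → ℝ)) [IsFiniteMeasure ρ],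
      (1 / (k' : ℝ)) * ∑ i, ∫ w, F i w ∂ρ = ∫ w, (1 / (k' : ℝ)) * ∑ i, F i w ∂ρ := by
    intro ρ _
    rw [integral_const_mul, integral_finsetSum]
    exact fun i _ => Integrable.of_bound (hFm i).aestronglyMeasurable 1
      (Filter.Eventually.of_forall fun w => by
        rw [Real.norm_of_nonneg (hF01 i w).1]
        exact (hF01 i w).2)
  rw [hmean] at h ⊢
  have hgm : Measurable fun w => (1 / (k' : ℝ)) * ∑ i, F i w :=
    (Finset.measurable_fun_sum _ fun i _ => hFm i).const_mul _
  have hg01 : ∀ w, (1 / (k' : ℝ)) * ∑ i, F i w ∈ Set.Icc (0 : ℝ) 1 := fun w =>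
    ⟨mul_nonneg (by positivity) (Finset.sum_nonneg fun i _ => (hF01 i w).1), by
      rw [one_div_mul_eq_div]
      exact (div_le_one hk).2 (hsum w)⟩
  subst hX hY hW
  have key := measureReal_sublevel_sub_integral_le (ν := volume) hpXm hpYm hpX0 hpY0 hgm hg01 μ
  exact sub_nonpos.1 (key.trans (mul_nonpos_of_nonneg_of_nonpos hμ.le (sub_nonpos.2 h)))
end

section
/- Let X have law N(x, σ²I) and Y have law N(x+δ, σ²I) on ℝ^d, let F₁, …, F_t : ℝ^d → {0,1} be random or deterministic measurable functions, and let k' be a positive integer such that ∑_{i=1}^t F_i(1|w) ≤ k' for all w ∈ ℝ^d. If W = {w ∈ ℝ^d : δᵀw ≤ β} for some β ∈ ℝ and (1/k') ∑_{i=1}^t Pr(F_i(X) = 1) ≥ Pr(X ∈ W), then (1/k') ∑_{i=1}^t Pr(F_i(Y) = 1) ≥ Pr(Y ∈ W). -/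
open MeasureTheory ProbabilityTheory

/-- A product of measures with densities is the product measure with the product density. -/
theorem pi_withDensity_ofReal {ι : Type*} [Fintype ι] {α : ι → Type*}
    [∀ i, MeasurableSpace (α i)] (μ : ∀ i, Measure (α i)) [∀ i, SigmaFinite (μ i)]
    (r : ∀ i, α i → ℝ) (hr0 : ∀ i a, 0 ≤ r i a) (hr : ∀ i, Integrable (r i) (μ i)) :
    Measure.pi (fun i => (μ i).withDensity fun a => ENNReal.ofReal (r i a)) =
      (Measure.pi μ).withDensity fun w => ENNReal.ofReal (∏ i, r i (w i)) := by
  have hfin (i) : IsFiniteMeasure ((μ i).withDensity fun a => ENNReal.ofReal (r i a)) :=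
    isFiniteMeasure_withDensity_ofReal (hr i).2
  refine Measure.pi_eq fun s hs => ?_
  rw [withDensity_apply _ (MeasurableSet.univ_pi hs), Measure.restrict_pi_pi,
    ← ofReal_integral_eq_lintegral_ofReal
      (Integrable.fintype_prod_dep fun i => (hr i).restrict)
      (ae_of_all _ fun w => Finset.prod_nonneg fun i _ => hr0 i _),
    integral_fintype_prod_eq_prod,
    ENNReal.ofReal_prod_of_nonneg fun i _ => integral_nonneg (hr0 i)]
  refine Finset.prod_congr rfl fun i _ => ?_
  rw [withDensity_apply _ (hs i),
    ofReal_integral_eq_lintegral_ofReal (hr i).restrict (ae_of_all _ (hr0 i))]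

/-- A real function is integrable when its positive part is the density of a finite measure and
it is nonnegative. -/
theorem integrable_of_eq_withDensity_ofReal {α : Type*} [MeasurableSpace α] {P Q : Measure α}
    [IsFiniteMeasure Q] {R : α → ℝ} (hRm : Measurable R) (hR0 : ∀ a, 0 ≤ R a)
    (hQ : Q = P.withDensity fun a => ENNReal.ofReal (R a)) : Integrable R P := by
  refine ⟨hRm.aestronglyMeasurable, ?_⟩
  rw [hasFiniteIntegral_iff_ofReal (ae_of_all _ hR0), ← setLIntegral_univ,
    ← withDensity_apply _ MeasurableSet.univ, ← hQ]
  exact measure_lt_top Q _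

/-- Shifting the mean of a one-dimensional Gaussian multiplies its density by an exponential. -/
theorem gaussianReal_add_eq_withDensity (m δ : ℝ) {v : NNReal} (hv : v ≠ 0) :
    gaussianReal (m + δ) v = (gaussianReal m v).withDensity
      fun w => ENNReal.ofReal (Real.exp ((δ * w - (δ * m + δ ^ 2 / 2)) / v)) := by
  rw [gaussianReal_of_var_ne_zero _ hv, gaussianReal_of_var_ne_zero _ hv,
    ← withDensity_mul _ (measurable_gaussianPDF _ _) (by fun_prop)]
  congr 1
  ext w
  have hv' : (v : ℝ) ≠ 0 := by exact_mod_cast hv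
  rw [Pi.mul_apply, gaussianPDF, gaussianPDF,
    ← ENNReal.ofReal_mul (gaussianPDFReal_nonneg _ _ _), gaussianPDFReal, gaussianPDFReal,
    mul_assoc (√(2 * Real.pi * v))⁻¹, ← Real.exp_add]
  congr 3
  field_simp
  ring

/-- Density of a shifted isotropic Gaussian with respect to the original one. -/
theorem gaussPi_add_eq_withDensity {d : ℕ} (x δ : Fin d → ℝ) {σ : ℝ} (hσ : 0 < σ) :
    gaussPi d (x + δ) σ = (gaussPi d x σ).withDensity fun w => ENNReal.ofReal
      (Real.exp ((dotp d δ w - ∑ i, (δ i * x i + δ i ^ 2 / 2)) / σ ^ 2)) := by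
  have hv : (σ ^ 2).toNNReal ≠ 0 := (Real.toNNReal_pos.2 (by positivity)).ne'
  simp only [gaussPi_eq_pi_toNNReal, Pi.add_apply, gaussianReal_add_eq_withDensity _ _ hv]
  rw [pi_withDensity_ofReal _
    (fun i w => Real.exp ((δ i * w - (δ i * x i + δ i ^ 2 / 2)) / (σ ^ 2).toNNReal))
    (fun _ _ => (Real.exp_pos _).le)
    (fun i => integrable_of_eq_withDensity_ofReal (by fun_prop) (fun _ => (Real.exp_pos _).le)
      (gaussianReal_add_eq_withDensity (x i) (δ i) hv))]
  congr 1
  ext w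
  rw [← Real.exp_sum, ← Finset.sum_div, Finset.sum_sub_distrib, Real.coe_toNNReal _ (sq_nonneg σ),
    dotp]

/-- Neyman–Pearson: a sublevel set `W` of the likelihood ratio `dQ/dP` has the least `Q`-mass
among tests `g` at least as likely as `W` under `P`. -/
theorem neymanPearson_le {α : Type*} [MeasurableSpace α] {P Q : Measure α} [IsFiniteMeasure P]
    [IsFiniteMeasure Q] {R : α → ℝ} (hRm : Measurable R) (hR0 : ∀ a, 0 ≤ R a)
    (hQ : Q = P.withDensity fun a => ENNReal.ofReal (R a)) {W : Set α} (hW : MeasurableSet W)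
    {l : ℝ} (hl : 0 ≤ l) (hRW : ∀ a ∈ W, R a ≤ l) (hRW' : ∀ a ∉ W, l ≤ R a)
    {g : α → ℝ} (hgm : Measurable g) (hg : ∀ a, g a ∈ Set.Icc (0 : ℝ) 1)
    (h : P.real W ≤ ∫ a, g a ∂P) : Q.real W ≤ ∫ a, g a ∂Q := by
  have hgint (M : Measure α) [IsFiniteMeasure M] : Integrable g M :=
    .of_mem_Icc 0 1 hgm.aemeasurable (ae_of_all _ hg)
  have hWint (M : Measure α) [IsFiniteMeasure M] : Integrable (W.indicator (1 : α → ℝ)) M :=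
    (integrable_const (1 : ℝ)).indicator hW
  have hsub (M : Measure α) [IsFiniteMeasure M] :
      ∫ a, (g a - W.indicator (1 : α → ℝ) a) ∂M = ∫ a, g a ∂M - M.real W := by
    rw [integral_sub (hgint M) (hWint M), integral_indicator_one hW]
  have hchange : ∫ a, (g a - W.indicator (1 : α → ℝ) a) ∂Q =
      ∫ a, R a * (g a - W.indicator (1 : α → ℝ) a) ∂P := by
    rw [hQ, integral_withDensity_eq_integral_toReal_smul (by fun_prop)
      (ae_of_all _ fun _ => ENNReal.ofReal_lt_top)]
    simp only [ENNReal.toReal_ofReal (hR0 _), smul_eq_mul]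
  have hRint : Integrable (fun a => R a * (g a - W.indicator (1 : α → ℝ) a)) P := by
    refine (integrable_of_eq_withDensity_ofReal hRm hR0 hQ).mul_bdd (c := 1)
      ((hgint P).sub (hWint P)).aestronglyMeasurable (ae_of_all _ fun a => ?_)
    obtain ⟨h0, h1⟩ := hg a
    by_cases ha : a ∈ W <;> simp [ha, abs_le] <;> constructor <;> linarith
  have hmono : ∫ a, l * (g a - W.indicator (1 : α → ℝ) a) ∂P ≤
      ∫ a, R a * (g a - W.indicator (1 : α → ℝ) a) ∂P := by
    refine integral_mono (((hgint P).sub (hWint P)).const_mul l) hRint fun a => ?_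
    obtain ⟨h0, h1⟩ := hg a
    by_cases ha : a ∈ W
    · simpa [ha] using mul_le_mul_of_nonpos_right (hRW a ha) (sub_nonpos.2 h1)
    · simpa [ha] using mul_le_mul_of_nonneg_right (hRW' a ha) h0
  rw [integral_const_mul, hsub P, ← hchange, hsub Q] at hmono
  linarith [mul_nonneg hl (sub_nonneg.2 h)]

/-- Neyman–Pearson variant for multiple functions and Gaussians, part (1):
`X ~ N(x, σ²I)`, `Y ~ N(x+δ, σ²I)`, measurable random functions `F₁,…,F_t`
(represented by `F i = F_i(1|·) : ℝ^d → [0,1]`) with `∑ᵢ F_i(1|w) ≤ k'` everywhere.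
If `W = {w | δᵀw ≤ β}` and `(1/k') ∑ᵢ Pr(F_i(X)=1) ≥ Pr(X ∈ W)`, then
`(1/k') ∑ᵢ Pr(F_i(Y)=1) ≥ Pr(Y ∈ W)`. -/
theorem stmt6 {d : ℕ} (x δ : Fin d → ℝ) (σ : ℝ) (hσ : 0 < σ)
    (t : ℕ) (F : Fin t → (Fin d → ℝ) → ℝ)
    (hFm : ∀ i, Measurable (F i)) (hF01 : ∀ i w, F i w ∈ Set.Icc (0 : ℝ) 1)
    (k' : ℕ) (hk' : 1 ≤ k') (hsum : ∀ w, ∑ i, F i w ≤ (k' : ℝ))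
    (β : ℝ) (W : Set (Fin d → ℝ)) (hW : W = {w | dotp d δ w ≤ β})
    (h : ((gaussPi d x σ) W).toReal ≤ (1 / (k' : ℝ)) * ∑ i, ∫ w, F i w ∂(gaussPi d x σ)) :
    ((gaussPi d (x + δ) σ) W).toReal ≤
      (1 / (k' : ℝ)) * ∑ i, ∫ w, F i w ∂(gaussPi d (x + δ) σ) := by
  have hk : (0 : ℝ) < k' := by exact_mod_cast hk'
  have hprob (m : Fin d → ℝ) : IsProbabilityMeasure (gaussPi d m σ) := by
    rw [gaussPi_eq_pi_toNNReal]; infer_instance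
  have hdotp : Measurable (dotp d δ) := by unfold dotp; fun_prop
  have havg (M : Measure (Fin d → ℝ)) [IsFiniteMeasure M] :
      ∫ w, (1 / (k' : ℝ)) * ∑ i, F i w ∂M = (1 / (k' : ℝ)) * ∑ i, ∫ w, F i w ∂M := by
    rw [integral_const_mul, integral_finsetSum _ fun i _ =>
      Integrable.of_mem_Icc 0 1 (hFm i).aemeasurable (ae_of_all _ (hF01 i))]
  rw [← havg] at h ⊢
  subst hW
  refine neymanPearson_le
    (l := Real.exp ((β - ∑ i, (δ i * x i + δ i ^ 2 / 2)) / σ ^ 2)) (by fun_prop)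
    (fun _ => (Real.exp_pos _).le) (gaussPi_add_eq_withDensity x δ hσ)
    (measurableSet_le hdotp measurable_const) (Real.exp_pos _).le (fun w hw => ?_)
    (fun w hw => ?_) (by fun_prop) (fun w => ⟨?_, ?_⟩) h
  · have hw' : dotp d δ w ≤ β := hw
    gcongr
  · have hw' : β ≤ dotp d δ w := (not_le.1 hw).le
    gcongr
  · exact mul_nonneg (by positivity) (Finset.sum_nonneg fun i _ => (hF01 i w).1)
  · rw [one_div, inv_mul_le_iff₀ hk, mul_one]
    exact hsum w
end

section
/- Let p* : {1,…,c} → [0,1] be any function (the adversarial label probabilities), let L ⊆ {1,…,c} with |L| = d, let k be an integer with 1 ≤ k ≤ c, let e be an integer with 1 ≤ e ≤ min(d, k), and let G ⊆ {1,…,c} with |G| = k be a top-k set under p*, i.e. p*_i ≥ p*_j for every i ∈ G and every j ∉ G. If |L ∩ G| < e, then min over all subsets U ⊆ L with |U| = d − e + 1 of max_{i∈U} p*_i is at most max over all subsets V ⊆ {1,…,c} \ L with |V| = k − e + 1 of min_{j∈V} p*_j. -/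
/-- Combinatorial necessary condition: let `p* : {1,…,c} → [0,1]`, `L` a label set with
`|L| = dl`, `1 ≤ k ≤ c`, `1 ≤ e ≤ min(dl,k)`, and let `G` be a top-`k` set under `p*`
(`|G| = k` and `p*_i ≥ p*_j` for `i ∈ G`, `j ∉ G`). If `|L ∩ G| < e`, then the minimum over
all `(dl−e+1)`-element subsets `U ⊆ L` of `max_{i∈U} p*_i` is at most the maximum over all
`(k−e+1)`-element subsets `V ⊆ {1,…,c} \ L` of `min_{j∈V} p*_j`. -/
theorem stmt14 (c : ℕ) (pstar : Fin c → ℝ) (hp : ∀ i, pstar i ∈ Set.Icc (0 : ℝ) 1)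
    (L : Finset (Fin c)) (dl : ℕ) (hdl : L.card = dl)
    (k : ℕ) (hk1 : 1 ≤ k) (hkc : k ≤ c)
    (e : ℕ) (he1 : 1 ≤ e) (hemin : e ≤ min dl k)
    (G : Finset (Fin c)) (hG : G.card = k)
    (htop : ∀ i ∈ G, ∀ j ∉ G, pstar j ≤ pstar i)
    (hlt : (L ∩ G).card < e) :
    sInf {m : ℝ | ∃ U : Finset (Fin c), U ⊆ L ∧ U.card = dl - e + 1 ∧
        m = sSup (pstar '' ↑U)} ≤
      sSup {m : ℝ | ∃ V : Finset (Fin c), (↑V : Set (Fin c)) ⊆ (↑L : Set (Fin c))ᶜ ∧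
        V.card = k - e + 1 ∧ m = sInf (pstar '' ↑V)} := by
  have hLG := Finset.card_sdiff_add_card_inter L G
  have hGL := Finset.card_sdiff_add_card_inter G L
  rw [Finset.inter_comm G L] at hGL
  have hed : e ≤ dl := hemin.trans (min_le_left _ _)
  have hek : e ≤ k := hemin.trans (min_le_right _ _)
  obtain ⟨U, hU, hUc⟩ := Finset.exists_subset_card_eq (s := L \ G) (n := dl - e + 1) (by omega)
  obtain ⟨V, hV, hVc⟩ := Finset.exists_subset_card_eq (s := G \ L) (n := k - e + 1) (by omega)
  have hUne : U.Nonempty := Finset.card_pos.mp (by omega)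
  have hVne : V.Nonempty := Finset.card_pos.mp (by omega)
  have hUV : sSup (pstar '' ↑U) ≤ sInf (pstar '' ↑V) := by
    refine csSup_le ((Finset.coe_nonempty.mpr hUne).image _) ?_
    rintro _ ⟨j, hj, rfl⟩
    refine le_csInf ((Finset.coe_nonempty.mpr hVne).image _) ?_
    rintro _ ⟨i, hi, rfl⟩
    exact htop i (Finset.mem_sdiff.mp (hV hi)).1 j (Finset.mem_sdiff.mp (hU hj)).2
  refine le_trans (csInf_le ?_ ⟨U, hU.trans Finset.sdiff_subset, hUc, rfl⟩) (le_trans hUV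
    (le_csSup ?_ ⟨V, fun i hi => (Finset.mem_sdiff.mp (hV hi)).2, hVc, rfl⟩))
  · refine ((Set.finite_range fun U : Finset (Fin c) => sSup (pstar '' ↑U)).subset ?_).bddBelow
    rintro _ ⟨U, -, -, rfl⟩
    exact ⟨U, rfl⟩
  · refine ((Set.finite_range fun V : Finset (Fin c) => sInf (pstar '' ↑V)).subset ?_).bddAbove
    rintro _ ⟨V, -, -, rfl⟩
    exact ⟨V, rfl⟩
end
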